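/- Each of the four graphs — the butterfly, the bowtie, K₄, and K_{1,1,3} — is in 𝒰; that is, each of these graphs supports an unsatisfiable simple 2-CNF. -/

import Mathlib

open SimpleGraph

namespace Sat2

abbrev Lit (V : Type) := V × Bool
abbrev TwoCNF (V : Type) := List (Lit V × Lit V)

/-- An assignment satisfies a 2-CNF if it satisfies at least one literal
of every clause. -/
def SatTwoCNF {V : Type} (τ : V → Bool) (S : TwoCNF V) : Prop :=
  ∀ c ∈ S, τ c.1.1 = c.1.2 ∨ τ c.2.1 = c.2.2

def TwoSatisfiable {V : Type} (S : TwoCNF V) : Prop := ∃ τ, SatTwoCNF τ S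

/-- The unordered pair of underlying variables of a 2-clause. -/
def clauseVars {V : Type} (c : Lit V × Lit V) : Sym2 V := s(c.1.1, c.2.1)

/-- A 2-CNF is simple if in every clause the two literals have distinct
underlying variables, and no two distinct clauses have the same unordered
pair of underlying variables. -/
def SimpleTwoCNF {V : Type} (S : TwoCNF V) : Prop :=
  (∀ c ∈ S, c.1.1 ≠ c.2.1) ∧ (S.map clauseVars).Nodup

/-- A 2-CNF `S` is supported on a simple graph `G` (with vertex type equal to
the variable type) when clause ↦ unordered pair of variables is a bijection
from the clauses of `S` onto the edges of `G`. -/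
def SupportedOn {V : Type} (S : TwoCNF V) (G : SimpleGraph V) : Prop :=
  (S.map clauseVars).Nodup ∧ {e : Sym2 V | e ∈ S.map clauseVars} = G.edgeSet

/-- `G ∈ 𝒰`: some unsatisfiable simple 2-CNF is supported on `G`. -/
def InU {V : Type} (G : SimpleGraph V) : Prop :=
  ∃ S : TwoCNF V, SimpleTwoCNF S ∧ SupportedOn S G ∧ ¬ TwoSatisfiable S

/-- `G` is isomorphic to a subgraph of `H`. -/
def IsSubgraphOf {α β : Type} (G : SimpleGraph α) (H : SimpleGraph β) : Prop :=
  ∃ f : α → β, Function.Injective f ∧ ∀ ⦃u v⦄, G.Adj u v → H.Adj (f u) (f v)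

/-- The graph obtained from `G` by subdividing the edge `(u, v)`:
the edge `(u,v)` is replaced by a path `u – w – v` through the
new vertex `w = none`. -/
def subdivideEdge {α : Type} (G : SimpleGraph α) (u v : α) :
    SimpleGraph (Option α) :=
  SimpleGraph.fromRel (fun a b =>
    match a, b with
    | some x, some y => G.Adj x y ∧ s(x, y) ≠ s(u, v)
    | some x, none => x = u ∨ x = v
    | _, _ => False)

/-- `IsSubdivision G H` : `H` is (up to starting isomorphism) obtained from `G`
by repeatedly subdividing edges. -/
inductive IsSubdivision : {α β : Type} → SimpleGraph α → SimpleGraph β → Prop where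
  | of_iso {α β : Type} {G : SimpleGraph α} {H : SimpleGraph β} :
      (G ≃g H) → IsSubdivision G H
  | step {α β : Type} {G : SimpleGraph α} {H : SimpleGraph β} (u v : β) :
      IsSubdivision G H → H.Adj u v → IsSubdivision G (subdivideEdge H u v)

/-- `G` is a topological minor of `H`: some subdivision of `G` is isomorphic
to a subgraph of `H`. -/
def IsTopMinor {α β : Type} (G : SimpleGraph α) (H : SimpleGraph β) : Prop :=
  ∃ (γ : Type) (G' : SimpleGraph γ), IsSubdivision G G' ∧ IsSubgraphOf G' H

/-- Contraction of the edge `(u,v)`: delete `v` and merge it into `u`. -/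
def contractEdge {α : Type} (G : SimpleGraph α) (u v : α) :
    SimpleGraph {w : α // w ≠ v} :=
  SimpleGraph.fromRel (fun a b =>
    G.Adj a.val b.val ∨ (a.val = u ∧ G.Adj v b.val) ∨ (b.val = u ∧ G.Adj a.val v))

/-- `ContractionSeq H G` : `G` can be obtained from `H` by a sequence of edge
contractions, each performed at an edge whose endpoints have no common
neighbor at the time of contraction. -/
inductive ContractionSeq : {α β : Type} → SimpleGraph α → SimpleGraph β → Prop where
  | of_iso {α β : Type} {H : SimpleGraph α} {G : SimpleGraph β} :
      (H ≃g G) → ContractionSeq H G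
  | step {α β : Type} {H : SimpleGraph α} {G : SimpleGraph β} (u v : α) :
      H.Adj u v → (∀ w, ¬(H.Adj u w ∧ H.Adj v w)) →
      ContractionSeq (contractEdge H u v) G → ContractionSeq H G

/-- The butterfly graph: two triangles sharing exactly one vertex. -/
def butterfly : SimpleGraph (Fin 5) :=
  SimpleGraph.fromEdgeSet {s(0,1), s(0,2), s(1,2), s(2,3), s(2,4), s(3,4)}

/-- The bowtie graph: two vertex-disjoint triangles joined by a single edge. -/
def bowtie : SimpleGraph (Fin 6) :=
  SimpleGraph.fromEdgeSet {s(0,1), s(0,2), s(1,2), s(2,3), s(3,4), s(3,5), s(4,5)}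

/-- The complete graph on four vertices. -/
def K4 : SimpleGraph (Fin 4) := ⊤

/-- The complete tripartite graph `K_{1,1,3}`, with parts {0}, {1}, {2,3,4}. -/
def K113 : SimpleGraph (Fin 5) :=
  SimpleGraph.fromEdgeSet {s(0,1), s(0,2), s(0,3), s(0,4), s(1,2), s(1,3), s(1,4)}

/-- The complete graph on four vertices with one edge deleted. -/
def K4minusE : SimpleGraph (Fin 4) :=
  SimpleGraph.fromEdgeSet {s(0,1), s(0,2), s(0,3), s(1,2), s(1,3)}

/-- A 2-CNF with distinct clause supports, whose clauses occupy exactly the edges of `G`,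
witnesses `G ∈ 𝒰` as soon as every assignment violates one of its clauses. -/
theorem inU_of_unsat {V : Type} {G : SimpleGraph V} (S : TwoCNF V)
    (hnodup : (S.map clauseVars).Nodup)
    (hedge : ∀ e : Sym2 V, e ∈ S.map clauseVars ↔ e ∈ G.edgeSet)
    (hunsat : ∀ τ : V → Bool, ∃ c ∈ S, τ c.1.1 ≠ c.1.2 ∧ τ c.2.1 ≠ c.2.2) : InU G := by
  refine ⟨S, ⟨fun c hc => ?_, hnodup⟩, ⟨hnodup, Set.ext hedge⟩, ?_⟩
  · exact G.ne_of_adj ((hedge (clauseVars c)).1 (List.mem_map_of_mem hc))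
  · rintro ⟨τ, hτ⟩
    obtain ⟨c, hc, h₁, h₂⟩ := hunsat τ
    exact (hτ c hc).elim h₁ h₂

theorem inU_butterfly : InU butterfly := by
  refine inU_of_unsat
    [((2, true), (0, true)), ((0, false), (1, true)), ((1, false), (2, true)),
      ((2, false), (3, true)), ((3, false), (4, true)), ((4, false), (2, false))]
    (by decide) ?_ (by decide)
  simp only [butterfly, edgeSet_fromEdgeSet]
  decide

theorem inU_bowtie : InU bowtie := by
  refine inU_of_unsat
    [((2, true), (0, true)), ((0, false), (1, true)), ((1, false), (2, true)),
      ((3, true), (4, true)), ((4, false), (5, true)), ((5, false), (3, true)),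
      ((2, false), (3, false))]
    (by decide) ?_ (by decide)
  simp only [bowtie, edgeSet_fromEdgeSet]
  decide

theorem inU_K4 : InU K4 := by
  refine inU_of_unsat
    [((0, true), (1, true)), ((0, true), (2, true)), ((0, false), (3, true)),
      ((1, false), (2, false)), ((1, true), (3, false)), ((2, true), (3, false))]
    (by decide) ?_ (by decide)
  simp only [K4, edgeSet_top]
  decide

/-- Resolving on each of `2`, `3`, `4` leaves, with the clause on the edge `01`,
all four clauses on the variables `0` and `1`. -/
theorem inU_K113 : InU K113 := by
  refine inU_of_unsat
    [((0, true), (1, true)), ((0, true), (2, true)), ((2, false), (1, false)),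
      ((0, false), (3, true)), ((3, false), (1, true)),
      ((0, false), (4, true)), ((4, false), (1, false))]
    (by decide) ?_ (by decide)
  simp only [K113, edgeSet_fromEdgeSet]
  decide

/-- Each of the butterfly, the bowtie, `K₄` and `K_{1,1,3}` supports an
unsatisfiable simple 2-CNF. -/
theorem stmt_16 : InU butterfly ∧ InU bowtie ∧ InU K4 ∧ InU K113 := by
  exact ⟨inU_butterfly, inU_bowtie, inU_K4, inU_K113⟩

end Sat2
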